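/- arXiv:2310.12402 — 2 statements merged into one kernel-verified Lean document; each statement's English description precedes it below -/
import Mathlib

section
/- Let X be a compact subset of Euclidean space ℝ^p and (Ω_Y, d) a compact metric space. Let f : X → Ω_Y be a continuous map such that the spread s_f(x₀) of f exists and is finite at every point x₀ of X. Then the difference quotient d(f(x), f(x')) / ‖x − x'‖ is bounded over all pairs x ≠ x' in X; i.e., there exists a constant C such that d(f(x), f(x')) ≤ C ‖x − x'‖ for all x, x' ∈ X. -/
open Filter Topology

/-- **Theorem 1(a)**: If `f : X → Ω_Y` is continuous on a compact set `X ⊆ ℝ^p` into a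
compact metric space, and the spread `s_f(x₀) = lim d(f x, f x')/‖x - x'‖` exists and is
finite at every point `x₀ ∈ X`, then the difference quotient is bounded on `X`. -/
theorem spread_finite_implies_lipschitz_on_compact
    {p : ℕ} {ΩY : Type*} [MetricSpace ΩY] [CompactSpace ΩY]
    (X : Set (EuclideanSpace ℝ (Fin p))) (hX : IsCompact X)
    (f : EuclideanSpace ℝ (Fin p) → ΩY) (hf : ContinuousOn f X)
    (s : EuclideanSpace ℝ (Fin p) → ℝ)
    (hs : ∀ x₀ ∈ X,
      Tendsto
        (fun q : EuclideanSpace ℝ (Fin p) × EuclideanSpace ℝ (Fin p) =>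
          dist (f q.1) (f q.2) / ‖q.1 - q.2‖)
        (𝓝[{q : EuclideanSpace ℝ (Fin p) × EuclideanSpace ℝ (Fin p) |
            q.1 ∈ X ∧ q.2 ∈ X ∧ q.1 ≠ q.2}] (x₀, x₀))
        (𝓝 (s x₀))) :
    ∃ C : ℝ, ∀ x ∈ X, ∀ x' ∈ X, dist (f x) (f x') ≤ C * ‖x - x'‖ := by
  have key : ∃ C : ℝ, ∀ q ∈ X ×ˢ X, dist (f q.1) (f q.2) ≤ C * ‖q.1 - q.2‖ := by
    refine (hX.prod hX).induction_on
      (p := fun S => ∃ C : ℝ, ∀ q ∈ S, dist (f q.1) (f q.2) ≤ C * ‖q.1 - q.2‖) ?_ ?_ ?_ ?_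
    · exact ⟨0, fun q hq => absurd hq (Set.notMem_empty q)⟩
    · rintro S T hST ⟨C, hC⟩
      exact ⟨C, fun q hq => hC q (hST hq)⟩
    · rintro S T ⟨C, hC⟩ ⟨D, hD⟩
      refine ⟨max C D, fun q hq => ?_⟩
      rcases hq with hq | hq
      · exact (hC q hq).trans (by gcongr; exact le_max_left _ _)
      · exact (hD q hq).trans (by gcongr; exact le_max_right _ _)
    · rintro ⟨a, b⟩ ⟨ha, hb⟩
      by_cases hab : a = b
      · subst hab
        have h := (hs a ha).eventually (gt_mem_nhds (lt_add_one (s a)))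
        rw [eventually_nhdsWithin_iff] at h
        refine ⟨{q | q ∈ X ×ˢ X ∧ dist (f q.1) (f q.2) ≤ (s a + 1) * ‖q.1 - q.2‖}, ?_,
          s a + 1, fun q hq => hq.2⟩
        filter_upwards [mem_nhdsWithin_of_mem_nhds h, self_mem_nhdsWithin] with q hq hqX
        refine ⟨hqX, ?_⟩
        by_cases hne : q.1 = q.2
        · simp [hne]
        · have h1 := hq ⟨hqX.1, hqX.2, hne⟩
          have h2 : 0 < ‖q.1 - q.2‖ := norm_pos_iff.mpr (sub_ne_zero.mpr hne)
          exact ((div_lt_iff₀ h2).mp h1).le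
      · have h0 : 0 < ‖a - b‖ := norm_pos_iff.mpr (sub_ne_zero.mpr hab)
        have hc : Continuous (fun q : EuclideanSpace ℝ (Fin p) × EuclideanSpace ℝ (Fin p) =>
            ‖q.1 - q.2‖) := by fun_prop
        have h := (hc.tendsto (a, b)).eventually (lt_mem_nhds (half_lt_self h0))
        refine ⟨{q | ‖a - b‖ / 2 < ‖q.1 - q.2‖}, mem_nhdsWithin_of_mem_nhds h,
          Metric.diam (Set.univ : Set ΩY) / (‖a - b‖ / 2), fun q hq => ?_⟩
        have hq' : ‖a - b‖ / 2 < ‖q.1 - q.2‖ := hq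
        have hd : dist (f q.1) (f q.2) ≤ Metric.diam (Set.univ : Set ΩY) :=
          Metric.dist_le_diam_of_mem isCompact_univ.isBounded (Set.mem_univ _) (Set.mem_univ _)
        have hd0 : 0 ≤ Metric.diam (Set.univ : Set ΩY) := Metric.diam_nonneg
        rw [div_mul_eq_mul_div, le_div_iff₀ (by positivity)]
        exact mul_le_mul hd hq'.le (by positivity) hd0
  obtain ⟨C, hC⟩ := key
  exact ⟨C, fun x hx x' hx' => hC (x, x') ⟨hx, hx'⟩⟩
end

section
/- Let X be a compact subset of Euclidean space ℝ^p and (Ω_Y, d) a compact metric space. Let f : X → Ω_Y be a map such that the spread s_f(x₀) exists and is finite at every point x₀ of X, and the function x₀ ↦ s_f(x₀) is continuous on X. Then the difference quotients converge to the spread uniformly: for every ε > 0 there exists δ > 0 such that for all x₀ ∈ X and all x, x' ∈ X with x ≠ x', ‖x − x₀‖ < δ and ‖x' − x₀‖ < δ, one has |d(f(x), f(x'))/‖x − x'‖ − s_f(x₀)| < ε. -/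
open Filter Topology

/-- **Theorem 1(b)**: If `f : X → Ω_Y` on a compact set `X ⊆ ℝ^p` into a compact metric
space has a finite spread `s_f(x₀)` at every point `x₀ ∈ X`, and `x₀ ↦ s_f(x₀)` is
continuous on `X`, then the difference quotients converge to the spread uniformly on `X`. -/
theorem spread_continuous_implies_uniform_convergence
    {p : ℕ} {ΩY : Type*} [MetricSpace ΩY] [CompactSpace ΩY]
    (X : Set (EuclideanSpace ℝ (Fin p))) (hX : IsCompact X)
    (f : EuclideanSpace ℝ (Fin p) → ΩY)
    (s : EuclideanSpace ℝ (Fin p) → ℝ)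
    (hs : ∀ x₀ ∈ X,
      Tendsto
        (fun q : EuclideanSpace ℝ (Fin p) × EuclideanSpace ℝ (Fin p) =>
          dist (f q.1) (f q.2) / ‖q.1 - q.2‖)
        (𝓝[{q : EuclideanSpace ℝ (Fin p) × EuclideanSpace ℝ (Fin p) |
            q.1 ∈ X ∧ q.2 ∈ X ∧ q.1 ≠ q.2}] (x₀, x₀))
        (𝓝 (s x₀)))
    (hscont : ContinuousOn s X) :
    ∀ ε > 0, ∃ δ > 0, ∀ x₀ ∈ X, ∀ x ∈ X, ∀ x' ∈ X, x ≠ x' →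
      ‖x - x₀‖ < δ → ‖x' - x₀‖ < δ →
      |dist (f x) (f x') / ‖x - x'‖ - s x₀| < ε := by
  intro ε hε
  suffices h : ∃ δ > 0, ∀ x₀ ∈ X, x₀ ∈ X → ∀ x ∈ X, ∀ x' ∈ X, x ≠ x' →
      ‖x - x₀‖ < δ → ‖x' - x₀‖ < δ →
      |dist (f x) (f x') / ‖x - x'‖ - s x₀| < ε by
    obtain ⟨δ, hδ, h⟩ := h
    exact ⟨δ, hδ, fun x₀ h₀ => h x₀ h₀ h₀⟩
  refine hX.induction_on (p := fun S => ∃ δ > 0, ∀ x₀ ∈ S, x₀ ∈ X → ∀ x ∈ X, ∀ x' ∈ X,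
      x ≠ x' → ‖x - x₀‖ < δ → ‖x' - x₀‖ < δ →
      |dist (f x) (f x') / ‖x - x'‖ - s x₀| < ε) ?_ ?_ ?_ ?_
  · exact ⟨1, one_pos, fun x₀ h => absurd h (Set.notMem_empty _)⟩
  · rintro S T hST ⟨δ, hδ, h⟩
    exact ⟨δ, hδ, fun x₀ h₀ => h x₀ (hST h₀)⟩
  · rintro S T ⟨δ, hδ, h⟩ ⟨δ', hδ', h'⟩
    refine ⟨min δ δ', lt_min hδ hδ', ?_⟩
    rintro x₀ (h₀ | h₀) hx₀ x hx x' hx' hne h1 h2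
    · exact h x₀ h₀ hx₀ x hx x' hx' hne (lt_of_lt_of_le h1 (min_le_left _ _))
        (lt_of_lt_of_le h2 (min_le_left _ _))
    · exact h' x₀ h₀ hx₀ x hx x' hx' hne (lt_of_lt_of_le h1 (min_le_right _ _))
        (lt_of_lt_of_le h2 (min_le_right _ _))
  · intro a ha
    obtain ⟨r₁, hr₁, h₁⟩ := Metric.tendsto_nhdsWithin_nhds.1 (hs a ha) (ε / 2) (half_pos hε)
    obtain ⟨r₂, hr₂, h₂⟩ := Metric.continuousOn_iff.1 hscont a ha (ε / 2) (half_pos hε)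
    have hr : 0 < min r₁ r₂ / 2 := half_pos (lt_min hr₁ hr₂)
    have m₁ := min_le_left r₁ r₂
    have m₂ := min_le_right r₁ r₂
    refine ⟨Metric.ball a (min r₁ r₂ / 2), mem_nhdsWithin_of_mem_nhds (Metric.ball_mem_nhds a hr),
      min r₁ r₂ / 2, hr, ?_⟩
    intro x₀ h₀ hx₀ x hx x' hx' hne hd hd'
    rw [Metric.mem_ball] at h₀
    rw [← dist_eq_norm] at hd hd'
    have t := dist_triangle x x₀ a
    have t' := dist_triangle x' x₀ a
    have q := @h₁ (x, x') ⟨hx, hx', hne⟩ (by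
      rw [Prod.dist_eq]
      exact max_lt (by dsimp only; linarith) (by dsimp only; linarith))
    have q' := h₂ x₀ hx₀ (by linarith)
    rw [Real.dist_eq, abs_lt] at q q'
    rw [abs_lt]
    dsimp only at q
    constructor <;> linarith [q.1, q.2, q'.1, q'.2]
end
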